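/- Let U be a square matrix over Γ_an,con with nonzero determinant. Then there exist a matrix V = 1 + Σ_{n=1}^∞ V_n t^n with entries in Ω_an and a matrix W with entries in Γ_con[1/p] such that U = VW. -/

import Mathlib

open scoped Classical

/-- The analytic setting.  `F = O[1/p]` is the fraction field of a complete discrete
valuation ring `O` which is a finite totally ramified extension of the Witt vectors of an
algebraically closed field `k` of characteristic `p` (encoded via the absolute value `abv`
with `abv p = 1/p`, discreteness, completeness, and algebraically closed residue field),
equipped with a Frobenius lift `σF`.  `Γac = Γ_{an,con}` is the ring of series
`∑_{n ∈ ℤ} cₙ tⁿ` with `cₙ ∈ F` such that `limsup_{n→+∞} |cₙ|^{1/n} ≤ 1` and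
`|cₙ| ≤ p^{cn+d}` for all `n < 0`, for some constants `c, d > 0`; it is encoded by its
coefficient functionals `coeff`, and carries the standard Frobenius `frob = σ_t`
(acting by `σ` on coefficients and sending `t` to `t^p`). -/
structure AnSetting (p : ℕ) [Fact p.Prime] where
  F : Type
  [fieldF : Field F]
  abv : F → ℝ
  abv_nonneg : ∀ x, 0 ≤ abv x
  abv_eq_zero : ∀ x, abv x = 0 ↔ x = 0
  abv_mul : ∀ x y, abv (x * y) = abv x * abv y
  abv_add_le : ∀ x y, abv (x + y) ≤ max (abv x) (abv y)
  abv_p : abv (p : F) = (p : ℝ)⁻¹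
  m : ℕ
  m_pos : 0 < m
  abv_discrete : ∀ x : F, x ≠ 0 → ∃ n : ℤ, abv x = (p : ℝ) ^ ((n : ℝ) / (m : ℝ))
  complete : ∀ f : ℕ → F,
    (∀ ε : ℝ, 0 < ε → ∃ N, ∀ a ≥ N, ∀ b ≥ N, abv (f a - f b) < ε) →
    ∃ x : F, ∀ ε : ℝ, 0 < ε → ∃ N, ∀ a ≥ N, abv (f a - x) < ε
  residue_algClosed : ∀ f : Polynomial F, f.Monic → (∀ i, abv (f.coeff i) ≤ 1) →
    0 < f.natDegree → ∃ x : F, abv x ≤ 1 ∧ abv (Polynomial.eval x f) < 1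
  σF : F ≃+* F
  abv_σF : ∀ x, abv (σF x) = abv x
  σF_frob : ∀ x : F, abv x ≤ 1 → abv (σF x - x ^ p) < 1
  Γac : Type
  [commΓac : CommRing Γac]
  coeff : Γac → ℤ → F
  coeff_injective : Function.Injective coeff
  coeff_add : ∀ x y i, coeff (x + y) i = coeff x i + coeff y i
  coeff_growth : ∀ (x : Γac) (ε : ℝ), 0 < ε → ∃ N : ℤ, 0 ≤ N ∧
    ∀ n : ℤ, N ≤ n → abv (coeff x n) ≤ (1 + ε) ^ n
  coeff_decay : ∀ x : Γac, ∃ c d : ℝ, 0 < c ∧ 0 < d ∧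
    ∀ n : ℤ, n < 0 → abv (coeff x n) ≤ (p : ℝ) ^ (c * (n : ℝ) + d)
  coeff_surjective : ∀ f : ℤ → F,
    (∀ ε : ℝ, 0 < ε → ∃ N : ℤ, 0 ≤ N ∧ ∀ n : ℤ, N ≤ n → abv (f n) ≤ (1 + ε) ^ n) →
    (∃ c d : ℝ, 0 < c ∧ 0 < d ∧ ∀ n : ℤ, n < 0 → abv (f n) ≤ (p : ℝ) ^ (c * (n : ℝ) + d)) →
    ∃ x, coeff x = f
  coeff_one : ∀ i, coeff 1 i = if i = 0 then 1 else 0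
  t : Γac
  coeff_t : ∀ i, coeff t i = if i = 1 then 1 else 0
  const : F →+* Γac
  coeff_const : ∀ a i, coeff (const a) i = if i = 0 then a else 0
  coeff_mul : ∀ (x y : Γac) (n : ℤ) (ε : ℝ), 0 < ε →
    ∃ S : Finset ℤ, ∀ T : Finset ℤ, S ⊆ T →
      abv (coeff (x * y) n - ∑ i ∈ T, coeff x i * coeff y (n - i)) < ε
  frob : Γac →+* Γac
  coeff_frob : ∀ x n, coeff (frob x) n =
    if (p : ℤ) ∣ n then σF (coeff x (n / (p : ℤ))) else 0

attribute [instance] AnSetting.fieldF AnSetting.commΓac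

namespace AnSetting

variable {p : ℕ} [Fact p.Prime] (S : AnSetting p)

/-- The subring `Ω_an ⊆ Γ_{an,con}` of rigid analytic functions on the open unit disc
(series with no negative-index coefficients), as a set. -/
def omegaAnSet : Set S.Γac := {x | ∀ i : ℤ, i < 0 → S.coeff x i = 0}

/-- The subring `Γ_con[1/p] ⊆ Γ_{an,con}`: the elements whose coefficients are bounded
above, as a set. -/
def conPSet : Set S.Γac := {x | ∃ C : ℝ, ∀ i : ℤ, S.abv (S.coeff x i) ≤ C}

/-- The subring `Γ_con ⊆ Γ_{an,con}`: the elements with integral coefficients, as a set. -/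
def conSet : Set S.Γac := {x | ∀ i : ℤ, S.abv (S.coeff x i) ≤ 1}

/-- The subring `Ω = O[[t]] ⊆ Γ_{an,con}`, as a set. -/
def omegaSet : Set S.Γac := {x | (∀ i : ℤ, S.abv (S.coeff x i) ≤ 1) ∧ ∀ i : ℤ, i < 0 → S.coeff x i = 0}

end AnSetting

namespace AnSetting

section aux

variable {p : ℕ} [Fact p.Prime] (S : AnSetting p)

/-- The `ρ`-Gauss norm of `x` is at most `C`. -/
def N (ρ : ℝ) (x : S.Γac) (C : ℝ) : Prop := ∀ n : ℤ, S.abv (S.coeff x n) * ρ ^ n ≤ C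

lemma abv_zero' : S.abv 0 = 0 := (S.abv_eq_zero 0).2 rfl

lemma abv_one' : S.abv 1 = 1 := by
  have h := S.abv_mul 1 1
  rw [mul_one] at h
  have h0 : S.abv 1 ≠ 0 := fun h => one_ne_zero ((S.abv_eq_zero 1).1 h)
  exact (mul_right_cancel₀ h0 (by rw [one_mul]; exact h)).symm

lemma abv_neg' (x : S.F) : S.abv (-x) = S.abv x := by
  have h : S.abv (-1) * S.abv (-1) = 1 := by
    rw [← S.abv_mul]; simp [S.abv_one']
  have h1 : S.abv (-1) = 1 := by nlinarith [S.abv_nonneg (-1)]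
  rw [← neg_one_mul, S.abv_mul, h1, one_mul]

lemma abv_sub_le' (x y : S.F) : S.abv (x - y) ≤ max (S.abv x) (S.abv y) := by
  rw [sub_eq_add_neg, ← S.abv_neg' y]; exact S.abv_add_le _ _

lemma abv_inv' (x : S.F) (hx : x ≠ 0) : S.abv x⁻¹ = (S.abv x)⁻¹ := by
  have h := S.abv_mul x x⁻¹
  rw [mul_inv_cancel₀ hx, S.abv_one'] at h
  exact eq_inv_of_mul_eq_one_right h.symm

lemma abv_pos' (x : S.F) (hx : x ≠ 0) : 0 < S.abv x :=
  lt_of_le_of_ne (S.abv_nonneg x) (fun h => hx ((S.abv_eq_zero x).1 h.symm))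

lemma abv_sum_le {ι : Type*} (s : Finset ι) (f : ι → S.F) (C : ℝ) (hC : 0 ≤ C)
    (h : ∀ i ∈ s, S.abv (f i) ≤ C) : S.abv (∑ i ∈ s, f i) ≤ C := by
  classical
  induction s using Finset.induction_on with
  | empty => simpa [S.abv_zero'] using hC
  | insert a s ha ih =>
    rw [Finset.sum_insert ha]
    exact (S.abv_add_le _ _).trans (max_le (h _ (by simp)) (ih fun i hi => h i (by simp [hi])))

/-- Coefficients as an additive hom. -/
def coeffHom (n : ℤ) : S.Γac →+ S.F :=
  AddMonoidHom.mk' (fun x => S.coeff x n) (fun x y => S.coeff_add x y n)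

lemma coeff_zero' (n : ℤ) : S.coeff 0 n = 0 := (S.coeffHom n).map_zero
lemma coeff_neg' (x : S.Γac) (n : ℤ) : S.coeff (-x) n = - S.coeff x n := (S.coeffHom n).map_neg x
lemma coeff_sub' (x y : S.Γac) (n : ℤ) : S.coeff (x - y) n = S.coeff x n - S.coeff y n :=
  (S.coeffHom n).map_sub x y
lemma coeff_sum' {ι : Type*} (s : Finset ι) (f : ι → S.Γac) (n : ℤ) :
    S.coeff (∑ i ∈ s, f i) n = ∑ i ∈ s, S.coeff (f i) n := map_sum (S.coeffHom n) f s

lemma ext' {x y : S.Γac} (h : ∀ n, S.coeff x n = S.coeff y n) : x = y :=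
  S.coeff_injective (funext h)

variable {S}

lemma N.mono {ρ : ℝ} {x : S.Γac} {C D : ℝ} (h : S.N ρ x C) (hCD : C ≤ D) : S.N ρ x D :=
  fun n => (h n).trans hCD

lemma N.nonneg {ρ : ℝ} (hρ : 0 < ρ) {x : S.Γac} {C : ℝ} (h : S.N ρ x C) : 0 ≤ C :=
  (mul_nonneg (S.abv_nonneg _) (zpow_pos hρ 0).le).trans (h 0)

lemma N.add {ρ : ℝ} (hρ : 0 < ρ) {x y : S.Γac} {C : ℝ} (hx : S.N ρ x C) (hy : S.N ρ y C) :
    S.N ρ (x + y) C := by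
  intro n
  rw [S.coeff_add]
  have h := mul_le_mul_of_nonneg_right (S.abv_add_le (S.coeff x n) (S.coeff y n)) (zpow_pos hρ n).le
  rw [max_mul_of_nonneg _ _ (zpow_pos hρ n).le] at h
  exact h.trans (max_le (hx n) (hy n))

lemma N.neg {ρ : ℝ} {x : S.Γac} {C : ℝ} (hx : S.N ρ x C) : S.N ρ (-x) C := by
  intro n
  rw [S.coeff_neg', S.abv_neg']; exact hx n

lemma N.sub {ρ : ℝ} (hρ : 0 < ρ) {x y : S.Γac} {C : ℝ} (hx : S.N ρ x C) (hy : S.N ρ y C) :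
    S.N ρ (x - y) C := by
  rw [sub_eq_add_neg]; exact hx.add hρ hy.neg

lemma N.zero {ρ : ℝ} {C : ℝ} (hC : 0 ≤ C) : S.N ρ 0 C := by
  intro n
  rw [S.coeff_zero', S.abv_zero', zero_mul]; exact hC

lemma N.sum {ρ : ℝ} (hρ : 0 < ρ) {ι : Type*} (s : Finset ι) (f : ι → S.Γac) {C : ℝ} (hC : 0 ≤ C)
    (h : ∀ i ∈ s, S.N ρ (f i) C) : S.N ρ (∑ i ∈ s, f i) C := by
  classical
  induction s using Finset.induction_on with
  | empty => simpa using N.zero hC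
  | insert a s ha ih =>
    rw [Finset.sum_insert ha]
    exact (h _ (by simp)).add hρ (ih fun i hi => h i (by simp [hi]))

lemma N.mul {ρ : ℝ} (hρ : 0 < ρ) {x y : S.Γac} {C D : ℝ} (hx : S.N ρ x C) (hy : S.N ρ y D) :
    S.N ρ (x * y) (C * D) := by
  intro n
  have hC := hx.nonneg hρ
  have hD := hy.nonneg hρ
  have hn := zpow_pos hρ n
  rw [← le_div_iff₀ hn]
  apply le_of_forall_pos_le_add
  intro ε hε
  obtain ⟨T, hT⟩ := S.coeff_mul x y n ε hε
  have h1 := hT T (Finset.Subset.refl _)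
  have h2 : S.abv (∑ i ∈ T, S.coeff x i * S.coeff y (n - i)) ≤ C * D / ρ ^ n := by
    apply S.abv_sum_le _ _ _ (by positivity)
    intro i _
    rw [le_div_iff₀ hn, S.abv_mul]
    have : ρ ^ n = ρ ^ i * ρ ^ (n - i) := by rw [← zpow_add₀ hρ.ne']; ring_nf
    rw [this, mul_mul_mul_comm]
    exact mul_le_mul (hx i) (hy _) (mul_nonneg (S.abv_nonneg _) (zpow_pos hρ _).le) hC
  have h3 := S.abv_add_le (S.coeff (x * y) n - ∑ i ∈ T, S.coeff x i * S.coeff y (n - i))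
    (∑ i ∈ T, S.coeff x i * S.coeff y (n - i))
  rw [sub_add_cancel] at h3
  refine h3.trans (max_le ?_ ?_)
  · have : 0 ≤ C * D / ρ ^ n := by positivity
    linarith
  · linarith

lemma N.one (ρ : ℝ) : S.N ρ 1 1 := by
  intro n
  rw [S.coeff_one]
  split_ifs with h
  · subst h; simp [S.abv_one']
  · simp [S.abv_zero']

lemma N_one_iff {x : S.Γac} {C : ℝ} : S.N 1 x C ↔ ∀ n, S.abv (S.coeff x n) ≤ C := by
  simp [N]

variable (S)

/-- subring of bounded elements. -/
def bdd : Subring S.Γac where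
  carrier := S.conPSet
  mul_mem' := by
    rintro x y ⟨C, hC⟩ ⟨D, hD⟩
    exact ⟨C * D, N_one_iff.1 ((N_one_iff.2 hC).mul one_pos (N_one_iff.2 hD))⟩
  one_mem' := ⟨1, N_one_iff.1 (N.one 1)⟩
  add_mem' := by
    rintro x y ⟨C, hC⟩ ⟨D, hD⟩
    exact ⟨max C D, N_one_iff.1 (((N_one_iff.2 hC).mono (le_max_left _ _)).add one_pos
      ((N_one_iff.2 hD).mono (le_max_right _ _)))⟩
  zero_mem' := ⟨0, N_one_iff.1 (N.zero le_rfl)⟩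
  neg_mem' := by
    rintro x ⟨C, hC⟩
    exact ⟨C, N_one_iff.1 (N_one_iff.2 hC).neg⟩

/-- subring of elements with `ρ`-norm at most `1`. -/
def ball (ρ : ℝ) (hρ : 0 < ρ) : Subring S.Γac where
  carrier := {x | S.N ρ x 1}
  mul_mem' := fun hx hy => by simpa using N.mul hρ hx hy
  one_mem' := N.one ρ
  add_mem' := fun hx hy => N.add hρ hx hy
  zero_mem' := N.zero zero_le_one
  neg_mem' := fun hx => N.neg hx

/-- ideal of elements with `ρ`-norm less than `1`. -/
def ballIdeal (ρ : ℝ) (hρ : 0 < ρ) : Ideal (S.ball ρ hρ) where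
  carrier := {x | ∃ θ < 1, S.N ρ (x : S.Γac) θ}
  add_mem' := by
    rintro x y ⟨C, hC, hx⟩ ⟨D, hD, hy⟩
    exact ⟨max C D, max_lt hC hD, (hx.mono (le_max_left _ _)).add hρ (hy.mono (le_max_right _ _))⟩
  zero_mem' := ⟨0, one_pos, N.zero le_rfl⟩
  smul_mem' := by
    rintro c x ⟨C, hC, hx⟩
    exact ⟨C, hC, by simpa using N.mul hρ c.2 hx⟩

lemma det_one_add_ne_zero (ρ : ℝ) (hρ : 0 < ρ) {r : ℕ} (E : Matrix (Fin r) (Fin r) S.Γac)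
    (θ : ℝ) (hθ : θ < 1) (hE : ∀ i j, S.N ρ (E i j) θ) : (1 + E).det ≠ 0 := by
  intro h0
  let E' : Matrix (Fin r) (Fin r) (S.ball ρ hρ) := fun i j => ⟨E i j, (hE i j).mono hθ.le⟩
  have h1 : (S.ball ρ hρ).subtype (1 + E').det = (1 + E).det := by
    rw [RingHom.map_det, map_add, map_one]
    congr 1
  have h2 : (Ideal.Quotient.mk (S.ballIdeal ρ hρ)) (1 + E').det = 1 := by
    rw [RingHom.map_det, map_add, map_one]
    have : (Ideal.Quotient.mk (S.ballIdeal ρ hρ)).mapMatrix E' = 0 := by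
      ext i j
      simp only [RingHom.mapMatrix_apply, Matrix.map_apply, Matrix.zero_apply]
      rw [Ideal.Quotient.eq_zero_iff_mem]
      exact ⟨θ, hθ, hE i j⟩
    rw [this, add_zero, Matrix.det_one]
  have h3 : (1 + E').det = 0 := by
    rw [h0] at h1
    exact Subtype.ext h1
  rw [h3, map_zero] at h2
  have h4 : (1 : S.ball ρ hρ) ∈ S.ballIdeal ρ hρ := by
    rw [← Ideal.Quotient.eq_zero_iff_mem, map_one]; exact h2.symm
  obtain ⟨θ', hθ', h5⟩ := h4
  have h6 := h5 0
  simp only [Subring.coe_one, S.coeff_one] at h6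
  simp [S.abv_one'] at h6
  linarith

lemma exists_of_trunc (x : S.Γac) (I : Set ℤ) :
    ∃ y : S.Γac, ∀ n, S.coeff y n = if n ∈ I then S.coeff x n else 0 := by
  suffices h : ∃ y, S.coeff y = (fun n => if n ∈ I then S.coeff x n else 0) by
    obtain ⟨y, hy⟩ := h
    exact ⟨y, fun n => by rw [hy]⟩
  apply S.coeff_surjective
  · intro ε hε
    obtain ⟨M, hM0, hM⟩ := S.coeff_growth x ε hε
    refine ⟨M, hM0, fun n hn => ?_⟩
    split_ifs
    · exact hM n hn
    · rw [S.abv_zero']; positivity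
  · obtain ⟨c, d, hc, hd, h⟩ := S.coeff_decay x
    refine ⟨c, d, hc, hd, fun n hn => ?_⟩
    split_ifs
    · exact h n hn
    · rw [S.abv_zero']; positivity

/-- projection to the coefficients in `I`. -/
noncomputable def proj (I : Set ℤ) (x : S.Γac) : S.Γac := (S.exists_of_trunc x I).choose

lemma coeff_proj (I : Set ℤ) (x : S.Γac) (n : ℤ) :
    S.coeff (S.proj I x) n = if n ∈ I then S.coeff x n else 0 :=
  (S.exists_of_trunc x I).choose_spec n

variable {S} in
lemma N.proj {ρ : ℝ} (hρ : 0 < ρ) {x : S.Γac} {C : ℝ} (hx : S.N ρ x C) (I : Set ℤ) :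
    S.N ρ (S.proj I x) C := by
  intro n
  rw [S.coeff_proj]
  split_ifs
  · exact hx n
  · rw [S.abv_zero', zero_mul]; exact hx.nonneg hρ

lemma p_pos : (1 : ℝ) < p := by exact_mod_cast (Fact.out : p.Prime).one_lt

/-- Building elements from bounded coefficients with finite `ρ`-norm. -/
lemma exists_of_bdd (ρ : ℝ) (hρ : 0 < ρ) (hρ1 : ρ < 1) (f : ℤ → S.F) (h1 : ∀ n, S.abv (f n) ≤ 1)
    (h2 : ∀ n, S.abv (f n) * ρ ^ n ≤ 1) : ∃ x, S.coeff x = f := by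
  apply S.coeff_surjective
  · intro ε hε
    refine ⟨0, le_rfl, fun n hn => (h1 n).trans ?_⟩
    exact one_le_zpow₀ (by linarith) hn
  · have hp : (1 : ℝ) < p := p_pos
    refine ⟨- Real.logb p ρ, 1, ?_, one_pos, fun n hn => ?_⟩
    · have := Real.logb_neg hp hρ hρ1
      linarith
    · have h := h2 n
      rw [← le_div_iff₀ (zpow_pos hρ n)] at h
      refine h.trans ?_
      have : (p : ℝ) ^ (-Real.logb p ρ * (n : ℝ)) = 1 / ρ ^ n := by
        rw [Real.rpow_mul (by linarith), Real.rpow_neg (by linarith),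
          Real.rpow_logb (by linarith) hp.ne' hρ, Real.rpow_intCast, inv_zpow, one_div]
      rw [← this]
      exact Real.rpow_le_rpow_of_exponent_le hp.le (by linarith)

end aux

end AnSetting

namespace AnSetting

section fixedpoint

variable {p : ℕ} [Fact p.Prime] (S : AnSetting p)

/-- Picard iteration. -/
noncomputable def iter {r : ℕ} (I : Set ℤ) (E : Matrix (Fin r) (Fin r) S.Γac) :
    ℕ → Matrix (Fin r) (Fin r) S.Γac
  | 0 => 0
  | k + 1 => fun i j => - S.proj I ((E + E * iter I E k) i j)

variable {S} in
lemma N.matMul {r : ℕ} {ρ : ℝ} (hρ : 0 < ρ) {A B : Matrix (Fin r) (Fin r) S.Γac} {C D : ℝ}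
    (hC : 0 ≤ C) (hD : 0 ≤ D)
    (hA : ∀ i j, S.N ρ (A i j) C) (hB : ∀ i j, S.N ρ (B i j) D) (i j : Fin r) :
    S.N ρ ((A * B) i j) (C * D) := by
  rw [Matrix.mul_apply]
  exact N.sum hρ _ _ (by positivity) fun l _ => (hA i l).mul hρ (hB l j)

lemma fixed_point (ρ : ℝ) (hρ : 0 < ρ) (hρ1 : ρ < 1) {r : ℕ} (E : Matrix (Fin r) (Fin r) S.Γac)
    (θ : ℝ) (hθ0 : 0 ≤ θ) (hθ : θ < 1) (hE : ∀ i j, S.N ρ (E i j) θ) (I : Set ℤ)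
    (hI : (∀ n ∈ I, n ≤ 0) ∨ (∀ i j n, S.abv (S.coeff (E i j) n) ≤ 1)) :
    ∃ G : Matrix (Fin r) (Fin r) S.Γac,
      (∀ i j, S.N ρ (G i j) θ) ∧ (∀ i j n, S.abv (S.coeff (G i j) n) ≤ 1) ∧
      (∀ i j n, n ∈ I → S.coeff ((G + E + E * G) i j) n = 0) := by
  set x := S.iter I E with hx
  have x0 : x 0 = 0 := rfl
  have xs : ∀ k i j, x (k + 1) i j = - S.proj I ((E + E * x k) i j) := fun k i j => rfl
  have ha : ∀ k i j, S.N ρ (x k i j) θ := by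
    intro k
    induction k with
    | zero => intro i j; rw [x0]; exact N.zero hθ0
    | succ k ih =>
      intro i j
      rw [xs, Matrix.add_apply]
      refine (N.proj hρ (N.add hρ (hE i j) ?_) I).neg
      exact (N.matMul hρ hθ0 hθ0 hE ih i j).mono (by nlinarith)
  have hd : ∀ k i j n, n ∉ I → S.coeff (x k i j) n = 0 := by
    intro k i j n hn
    cases k with
    | zero => rw [x0]; exact S.coeff_zero' n
    | succ k => rw [xs, S.coeff_neg', S.coeff_proj, if_neg hn, neg_zero]
  have hb : ∀ k i j n, S.abv (S.coeff (x k i j) n) ≤ 1 := by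
    rcases hI with hI | hI
    · intro k i j n
      by_cases hn : n ∈ I
      · have h := ha k i j n
        have h1 : 1 ≤ ρ ^ n := one_le_zpow_of_nonpos₀ hρ hρ1.le (hI n hn)
        nlinarith [S.abv_nonneg (S.coeff (x k i j) n)]
      · rw [hd k i j n hn, S.abv_zero']; exact zero_le_one
    · have hE1 : ∀ i j, S.N 1 (E i j) 1 := fun i j => N_one_iff.2 (hI i j)
      have : ∀ k i j, S.N 1 (x k i j) 1 := by
        intro k
        induction k with
        | zero => intro i j; rw [x0]; exact N.zero zero_le_one
        | succ k ih =>
          intro i j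
          rw [xs, Matrix.add_apply]
          refine (N.proj one_pos (N.add one_pos (hE1 i j) ?_) I).neg
          exact (N.matMul one_pos zero_le_one zero_le_one hE1 ih i j).mono (by norm_num)
      exact fun k i j => N_one_iff.1 (this k i j)
  have hc : ∀ k i j, S.N ρ (x (k + 1) i j - x k i j) (θ ^ (k + 1)) := by
    intro k
    induction k with
    | zero => intro i j; rw [x0]; simpa using ha 1 i j
    | succ k ih =>
      intro i j
      have h1 : S.N ρ ((E * (x (k + 1) - x k)) i j) (θ * θ ^ (k + 1)) :=
        N.matMul hρ hθ0 (by positivity) hE ih i j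
      have h2 : x (k + 1 + 1) i j - x (k + 1) i j = - S.proj I ((E * (x (k + 1) - x k)) i j) := by
        apply S.ext'
        intro n
        rw [xs, xs k]
        simp only [S.coeff_sub', S.coeff_neg', S.coeff_proj, Matrix.mul_sub, Matrix.sub_apply,
          Matrix.add_apply, S.coeff_add]
        split_ifs <;> ring
      rw [h2, pow_succ' θ (k + 1)]
      exact (h1.proj hρ I).neg
  have hcau : ∀ k l i j, S.N ρ (x (k + l) i j - x k i j) (θ ^ (k + 1)) := by
    intro k l i j
    induction l with
    | zero => simpa using N.zero (by positivity)
    | succ l ih =>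
      have h1 := hc (k + l) i j
      have h2 : θ ^ (k + l + 1) ≤ θ ^ (k + 1) := pow_le_pow_of_le_one hθ0 hθ.le (by omega)
      have h3 := (h1.mono h2).add hρ ih
      rw [sub_add_sub_cancel] at h3
      exact h3
  have hlim : ∀ i j n, ∃ g : S.F, ∀ ε : ℝ, 0 < ε → ∃ M, ∀ a ≥ M,
      S.abv (S.coeff (x a i j) n - g) < ε := by
    intro i j n
    apply S.complete
    intro ε hε
    have hn := zpow_pos hρ n
    obtain ⟨k, hk⟩ := exists_pow_lt_of_lt_one (mul_pos hε hn) hθ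
    have key : ∀ a ≥ k, S.abv (S.coeff (x a i j) n - S.coeff (x k i j) n) < ε := by
      intro a ha
      obtain ⟨l, rfl⟩ := Nat.exists_eq_add_of_le ha
      have h1 := hcau k l i j n
      rw [S.coeff_sub'] at h1
      have h2 : θ ^ (k + 1) ≤ θ ^ k := pow_le_pow_of_le_one hθ0 hθ.le (by omega)
      by_contra hcon
      push Not at hcon
      nlinarith
    refine ⟨k, fun a ha b hb => ?_⟩
    have h := S.abv_sub_le' (S.coeff (x a i j) n - S.coeff (x k i j) n)
      (S.coeff (x b i j) n - S.coeff (x k i j) n)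
    rw [sub_sub_sub_cancel_right] at h
    exact h.trans_lt (max_lt (key a ha) (key b hb))
  choose g hg using hlim
  -- closeness of limit
  have hgle : ∀ i j n (y : S.F) (k : ℕ) (C : ℝ), 0 ≤ C →
      (∀ l, S.abv (S.coeff (x (k + l) i j) n - y) ≤ C) → S.abv (g i j n - y) ≤ C := by
    intro i j n y k C hC h
    apply le_of_forall_pos_le_add
    intro ε hε
    obtain ⟨M, hM⟩ := hg i j n ε hε
    have h1 := hM (k + M) (by omega)
    have h2 := S.abv_sub_le' (S.coeff (x (k + M) i j) n - y) (S.coeff (x (k + M) i j) n - g i j n)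
    rw [sub_sub_sub_cancel_left] at h2
    refine h2.trans (max_le ?_ ?_)
    · linarith [h M]
    · linarith
  have hg1 : ∀ i j n, S.abv (g i j n) ≤ 1 := by
    intro i j n
    have := hgle i j n 0 0 1 zero_le_one (fun l => by rw [sub_zero]; exact hb _ _ _ _)
    rwa [sub_zero] at this
  have hgd : ∀ k i j n, S.abv (g i j n - S.coeff (x k i j) n) * ρ ^ n ≤ θ ^ (k + 1) := by
    intro k i j n
    have hn := zpow_pos hρ n
    rw [← le_div_iff₀ hn]
    apply hgle i j n _ k _ (by positivity)
    intro l
    rw [le_div_iff₀ hn, ← S.coeff_sub']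
    exact hcau k l i j n
  have hgρ : ∀ i j n, S.abv (g i j n) * ρ ^ n ≤ θ := by
    intro i j n
    have := hgd 0 i j n
    rw [x0] at this
    simpa [S.coeff_zero'] using this
  have hG : ∀ i j, ∃ y, S.coeff y = g i j := fun i j =>
    S.exists_of_bdd ρ hρ hρ1 (g i j) (hg1 i j) (fun n => (hgρ i j n).trans hθ.le)
  choose G hGc using hG
  refine ⟨G, fun i j n => by rw [hGc]; exact hgρ i j n, fun i j n => by rw [hGc]; exact hg1 i j n, ?_⟩
  intro i j n hn
  have hGN : ∀ k i j, S.N ρ ((Matrix.of G - x k) i j) (θ ^ (k + 1)) := by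
    intro k i j n
    rw [Matrix.sub_apply, S.coeff_sub', Matrix.of_apply, hGc]
    exact hgd k i j n
  have hk : ∀ k : ℕ, S.abv (S.coeff ((Matrix.of G + E + E * Matrix.of G) i j) n) * ρ ^ n
      ≤ θ ^ (k + 1) := by
    intro k
    have h1 := hGN (k + 1) i j
    have h2 : S.N ρ ((E * (Matrix.of G - x k)) i j) (θ * θ ^ (k + 1)) :=
        N.matMul hρ hθ0 (by positivity) hE (hGN k) i j
    rw [← pow_succ'] at h2
    have h3 := (h1.add hρ h2).mono (pow_le_pow_of_le_one hθ0 hθ.le (by omega : k + 1 ≤ k + 1 + 1)) n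
    have h4 : S.coeff ((Matrix.of G + E + E * Matrix.of G) i j) n =
        S.coeff ((Matrix.of G - x (k + 1)) i j + (E * (Matrix.of G - x k)) i j) n := by
      rw [Matrix.sub_apply, xs]
      simp only [S.coeff_sub', S.coeff_neg', S.coeff_proj, Matrix.mul_sub, Matrix.sub_apply,
          Matrix.add_apply, S.coeff_add, if_pos hn]
      ring
    rw [h4]; exact h3
  have hn' := zpow_pos hρ n
  by_contra hne
  have hpos := mul_pos (S.abv_pos' _ hne) hn'
  obtain ⟨k, hk'⟩ := exists_pow_lt_of_lt_one hpos hθ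
  have h2 : θ ^ (k + 1) ≤ θ ^ k := pow_le_pow_of_le_one hθ0 hθ.le (by omega)
  have := hk k
  exact absurd (this.trans h2) (not_le.2 hk')

end fixedpoint

end AnSetting

namespace AnSetting

section approx

open Filter Topology

variable {p : ℕ} [Fact p.Prime] (S : AnSetting p)

lemma exists_mono (a : S.F) (k : ℤ) :
    ∃ x : S.Γac, ∀ n, S.coeff x n = if n = k then a else 0 := by
  suffices h : ∃ y, S.coeff y = (fun n => if n = k then a else 0) by
    obtain ⟨y, hy⟩ := h
    exact ⟨y, fun n => by rw [hy]⟩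
  have hp : (1 : ℝ) < p := p_pos
  apply S.coeff_surjective
  · intro ε hε
    refine ⟨max 0 (k + 1), le_max_left _ _, fun n hn => ?_⟩
    have : k + 1 ≤ n := (le_max_right _ _).trans hn
    rw [if_neg (by omega), S.abv_zero']
    positivity
  · obtain ⟨d, hd⟩ := pow_unbounded_of_one_lt (S.abv a) hp
    refine ⟨1, d + |(k : ℝ)| + 1, one_pos, by positivity, fun n hn => ?_⟩
    split_ifs with h
    · subst h
      refine hd.le.trans ?_
      rw [← Real.rpow_natCast]
      apply Real.rpow_le_rpow_of_exponent_le hp.le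
      linarith [neg_abs_le (n : ℝ)]
    · rw [S.abv_zero']; positivity

/-- the monomial `a t^k`. -/
noncomputable def mono (a : S.F) (k : ℤ) : S.Γac := (S.exists_mono a k).choose

lemma coeff_mono (a : S.F) (k n : ℤ) : S.coeff (S.mono a k) n = if n = k then a else 0 :=
  (S.exists_mono a k).choose_spec n

lemma eq_of_close (a b : S.F) (h : ∀ ε : ℝ, 0 < ε → S.abv (a - b) < ε) : a = b := by
  by_contra hne
  exact lt_irrefl _ (h _ (S.abv_pos' _ (sub_ne_zero.2 hne)))

lemma coeff_mono_mul (a : S.F) (k : ℤ) (x : S.Γac) (n : ℤ) :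
    S.coeff (S.mono a k * x) n = a * S.coeff x (n - k) := by
  apply S.eq_of_close
  intro ε hε
  obtain ⟨T, hT⟩ := S.coeff_mul (S.mono a k) x n ε hε
  have h := hT (insert k T) (Finset.subset_insert _ _)
  rw [Finset.sum_eq_single_of_mem k (Finset.mem_insert_self _ _)] at h
  · simpa [S.coeff_mono] using h
  · intro i _ hi
    rw [S.coeff_mono, if_neg hi, zero_mul]

lemma mono_mem_bdd (a : S.F) (k : ℤ) : S.mono a k ∈ S.bdd := by
  refine ⟨S.abv a, fun n => ?_⟩
  rw [S.coeff_mono]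
  split_ifs
  · exact le_rfl
  · rw [S.abv_zero']; exact S.abv_nonneg a

/-- subring of Laurent polynomials. -/
def fin : Subring S.Γac where
  carrier := {x | ∃ M : ℕ, ∀ n : ℤ, (M : ℤ) < |n| → S.coeff x n = 0}
  mul_mem' := by
    rintro x y ⟨C, hC⟩ ⟨D, hD⟩
    refine ⟨C + D, fun n hn => ?_⟩
    apply S.eq_of_close
    intro ε hε
    obtain ⟨T, hT⟩ := S.coeff_mul x y n ε hε
    have h := hT T (Finset.Subset.refl _)
    rw [Finset.sum_eq_zero] at h
    · exact h
    · intro i _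
      by_cases hi : (C : ℤ) < |i|
      · rw [hC i hi, zero_mul]
      · rw [hD (n - i), mul_zero]
        push_cast at hn
        have := abs_add_le (n - i) i
        rw [sub_add_cancel] at this
        omega
  one_mem' := ⟨0, fun n hn => by
    rw [S.coeff_one, if_neg]
    rintro rfl
    simp at hn⟩
  add_mem' := by
    rintro x y ⟨C, hC⟩ ⟨D, hD⟩
    refine ⟨C + D, fun n hn => ?_⟩
    push_cast at hn
    rw [S.coeff_add, hC n (by omega), hD n (by omega), add_zero]
  zero_mem' := ⟨0, fun n hn => S.coeff_zero' n⟩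
  neg_mem' := by
    rintro x ⟨C, hC⟩
    exact ⟨C, fun n hn => by rw [S.coeff_neg', hC n hn, neg_zero]⟩

lemma fin_le_bdd : S.fin ≤ S.bdd := by
  rintro x ⟨M, hM⟩
  refine ⟨∑ i ∈ Finset.Icc (-(M : ℤ)) M, S.abv (S.coeff x i), fun n => ?_⟩
  by_cases hn : (M : ℤ) < |n|
  · rw [hM n hn, S.abv_zero']
    exact Finset.sum_nonneg fun i _ => S.abv_nonneg _
  · apply Finset.single_le_sum (f := fun i => S.abv (S.coeff x i)) (fun i _ => S.abv_nonneg _)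
    rw [Finset.mem_Icc]
    exact abs_le.1 (not_lt.1 hn)

lemma fin_lt (s : Finset ℤ) (f : ℤ → ℝ) (B : ℝ) (hB : 0 < B) (h : ∀ n ∈ s, f n < B) :
    ∃ B', 0 ≤ B' ∧ B' < B ∧ ∀ n ∈ s, f n ≤ B' := by
  induction s using Finset.induction_on with
  | empty => exact ⟨0, le_rfl, hB, by simp⟩
  | insert a s ha ih =>
    obtain ⟨B', h0, h1, h2⟩ := ih fun n hn => h n (by simp [hn])
    refine ⟨max B' (f a), h0.trans (le_max_left _ _), max_lt h1 (h a (by simp)), ?_⟩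
    intro n hn
    rcases Finset.mem_insert.1 hn with rfl | hn
    · exact le_max_right _ _
    · exact (h2 n hn).trans (le_max_left _ _)

lemma inv_fin (f : S.Γac) (hf : f ∈ S.fin) (hf0 : f ≠ 0) : ∃ g ∈ S.bdd, f * g = 1 := by
  obtain ⟨M, hM⟩ := hf
  set s := Finset.Icc (-(M : ℤ)) M with hs
  have hmem : ∀ n, S.coeff f n ≠ 0 → n ∈ s := by
    intro n hn
    rw [hs, Finset.mem_Icc]
    by_contra hcon
    exact hn (hM n (by rw [← abs_le] at hcon; omega))
  obtain ⟨n1, hn1⟩ : ∃ n, S.coeff f n ≠ 0 := by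
    by_contra hcon
    push Not at hcon
    exact hf0 (S.ext' fun n => by rw [hcon, S.coeff_zero'])
  obtain ⟨k0, hk0s, hk0⟩ := Finset.exists_max_image s (fun n => S.abv (S.coeff f n))
    ⟨n1, hmem _ hn1⟩
  set A := S.abv (S.coeff f k0) with hA
  have hApos : 0 < A := (S.abv_pos' _ hn1).trans_le (hk0 n1 (hmem _ hn1))
  have hle : ∀ n, S.abv (S.coeff f n) ≤ A := by
    intro n
    by_cases hn : S.coeff f n = 0
    · rw [hn, S.abv_zero']; exact hApos.le
    · exact hk0 n (hmem n hn)
  obtain ⟨k, hks, hkmin⟩ := Finset.exists_min_image (s.filter fun n => S.abv (S.coeff f n) = A) id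
    ⟨k0, by simp [hk0s, hA]⟩
  rw [Finset.mem_filter] at hks
  have hlt : ∀ n, n < k → S.abv (S.coeff f n) < A := by
    intro n hn
    refine lt_of_le_of_ne (hle n) fun heq => ?_
    have hn0 : S.coeff f n ≠ 0 := fun h0 => by
      rw [h0, S.abv_zero'] at heq; exact hApos.ne heq
    have := hkmin n (by rw [Finset.mem_filter]; exact ⟨hmem n hn0, heq⟩)
    simp only [id] at this
    omega
  set c := S.coeff f k with hc
  have hc0 : c ≠ 0 := fun h0 => by
    have := hks.2
    rw [h0, S.abv_zero'] at this; exact hApos.ne this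
  set u := S.mono c⁻¹ (-k) with hu
  set e := u * f - 1 with he
  have hecoeff : ∀ n, S.coeff e n = c⁻¹ * S.coeff f (n + k) - if n = 0 then 1 else 0 := by
    intro n
    rw [he, S.coeff_sub', hu, S.coeff_mono_mul, S.coeff_one, sub_neg_eq_add]
  have he0 : S.coeff e 0 = 0 := by
    rw [hecoeff, zero_add, ← hc, inv_mul_cancel₀ hc0]; simp
  have hene : ∀ n, n ≠ 0 → S.abv (S.coeff e n) = S.abv (S.coeff f (n + k)) / A := by
    intro n hn
    rw [hecoeff, if_neg hn, sub_zero, S.abv_mul, S.abv_inv' _ hc0, hks.2, div_eq_inv_mul]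
  have he1 : ∀ n, S.abv (S.coeff e n) ≤ 1 := by
    intro n
    by_cases hn : n = 0
    · rw [hn, he0, S.abv_zero']; exact zero_le_one
    · rw [hene n hn, div_le_one hApos]; exact hle _
  have helt : ∀ n, n < 0 → S.abv (S.coeff e n) < 1 := by
    intro n hn
    rw [hene n hn.ne, div_lt_one hApos]; exact hlt _ (by omega)
  have hez : ∀ n, n < -((2 * M : ℕ) : ℤ) → S.coeff e n = 0 := by
    intro n hn
    have hk1 := (Finset.mem_Icc.1 hks.1)
    push_cast at hn
    rw [hecoeff, if_neg (by omega), hM, mul_zero, sub_zero]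
    rw [lt_abs]; right; omega
  obtain ⟨q, hq0, hq1, hq⟩ := fin_lt (Finset.Icc (-((2 * M : ℕ) : ℤ)) (-1))
    (fun n => S.abv (S.coeff e n)) 1 one_pos (fun n hn => helt n (by
      rw [Finset.mem_Icc] at hn; omega))
  obtain ⟨ρ, hρq, hρ0, hρ1⟩ : ∃ ρ : ℝ, q < ρ ^ (2 * M) ∧ 0 < ρ ∧ ρ < 1 := by
    have h1 : ∀ᶠ ρ : ℝ in 𝓝 1, q < ρ ^ (2 * M) := by
      have := (continuous_pow (M := ℝ) (2 * M)).tendsto 1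
      rw [one_pow] at this
      exact this.eventually_const_lt hq1
    have h2 : ∀ᶠ ρ : ℝ in 𝓝 1, 0 < ρ := eventually_gt_nhds one_pos
    have h3 : ∀ᶠ ρ : ℝ in 𝓝[<] 1, q < ρ ^ (2 * M) ∧ 0 < ρ ∧ ρ < 1 := by
      filter_upwards [nhdsWithin_le_nhds h1, nhdsWithin_le_nhds h2, self_mem_nhdsWithin]
        with ρ a b c using ⟨a, b, c⟩
    exact h3.exists
  have hρM : 0 < ρ ^ (2 * M) := by positivity
  set θ := max ρ (q / ρ ^ (2 * M)) with hθ
  have hθ1 : θ < 1 := max_lt hρ1 ((div_lt_one hρM).2 hρq)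
  have hθ0 : 0 ≤ θ := hρ0.le.trans (le_max_left _ _)
  have heN : S.N ρ e θ := by
    intro n
    rcases lt_trichotomy n 0 with hn | hn | hn
    · by_cases hn2 : n < -((2 * M : ℕ) : ℤ)
      · rw [hez n hn2, S.abv_zero', zero_mul]; exact hθ0
      · refine le_trans ?_ (le_max_right _ _)
        have h1 := hq n (by rw [Finset.mem_Icc]; omega)
        have h2 : ρ ^ n ≤ ρ ^ (-((2 * M : ℕ) : ℤ)) :=
          zpow_le_zpow_right_of_le_one₀ hρ0 hρ1.le (not_lt.1 hn2)
        rw [zpow_neg, zpow_natCast] at h2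
        rw [div_eq_mul_inv]
        exact mul_le_mul h1 h2 (zpow_pos hρ0 n).le hq0
    · rw [hn, he0, S.abv_zero', zero_mul]; exact hθ0
    · refine le_trans ?_ (le_max_left _ _)
      have h2 : ρ ^ n ≤ ρ ^ (1 : ℤ) := zpow_le_zpow_right_of_le_one₀ hρ0 hρ1.le (by omega)
      rw [zpow_one] at h2
      calc S.abv (S.coeff e n) * ρ ^ n ≤ 1 * ρ :=
            mul_le_mul (he1 n) h2 (zpow_pos hρ0 n).le zero_le_one
        _ = ρ := one_mul ρ
  obtain ⟨G, _, hG1, hG2⟩ := S.fixed_point ρ hρ0 hρ1 (r := 1) (Matrix.of fun _ _ => e) θ hθ0 hθ1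
    (fun _ _ => heN) Set.univ (Or.inr fun _ _ => he1)
  have hG3 : G 0 0 + e + e * G 0 0 = 0 := by
    apply S.ext'
    intro n
    have := hG2 0 0 n (Set.mem_univ _)
    rw [S.coeff_zero', ← this]
    simp [Matrix.add_apply, Matrix.mul_apply]
  refine ⟨u * (1 + G 0 0), S.bdd.mul_mem (S.mono_mem_bdd _ _)
    (S.bdd.add_mem S.bdd.one_mem ⟨1, hG1 0 0⟩), ?_⟩
  have h1 : u * f = 1 + e := by rw [he]; ring
  calc f * (u * (1 + G 0 0)) = (u * f) * (1 + G 0 0) := by ring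
    _ = 1 + (G 0 0 + e + e * G 0 0) := by rw [h1]; ring
    _ = 1 := by rw [hG3, add_zero]

/-- coefficients tend to zero at radius `ρ`. -/
def Tail (ρ : ℝ) (x : S.Γac) : Prop :=
  ∀ ε : ℝ, 0 < ε → ∃ M : ℕ, ∀ n : ℤ, (M : ℤ) < |n| → S.abv (S.coeff x n) * ρ ^ n ≤ ε

lemma eventually_tail (x : S.Γac) : ∀ᶠ ρ : ℝ in 𝓝[<] 1, S.Tail ρ x := by
  have hp : (1 : ℝ) < p := p_pos
  obtain ⟨c, d, hc, hd, h⟩ := S.coeff_decay x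
  have hpc : (p : ℝ) ^ (-c) < 1 := Real.rpow_lt_one_of_one_lt_of_neg hp (by linarith)
  have h1 : ∀ᶠ ρ : ℝ in 𝓝 1, (p : ℝ) ^ (-c) < ρ := eventually_gt_nhds hpc
  filter_upwards [nhdsWithin_le_nhds h1, self_mem_nhdsWithin] with ρ hρ hρ1
  simp only [Set.mem_Iio] at hρ1
  have hpc0 : 0 < (p : ℝ) ^ (-c) := by positivity
  have hρ0 : 0 < ρ := hpc0.trans hρ
  intro ε hε
  -- negative part
  obtain ⟨M1, hM1⟩ : ∃ M1 : ℕ, ∀ k : ℕ, M1 ≤ k → S.abv (S.coeff x (-(k + 1 : ℕ))) *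
      ρ ^ (-((k + 1 : ℕ) : ℤ)) ≤ ε := by
    have ha : (p : ℝ) ^ (-c) / ρ < 1 := (div_lt_one hρ0).2 hρ
    have ha0 : 0 ≤ (p : ℝ) ^ (-c) / ρ := by positivity
    have hpd : 0 < (p : ℝ) ^ d := by positivity
    obtain ⟨M1, hM1⟩ := exists_pow_lt_of_lt_one (div_pos hε hpd) ha
    refine ⟨M1, fun k hk => ?_⟩
    have h2 := h (-(k + 1 : ℕ)) (by omega)
    have h3 : (p : ℝ) ^ (c * ((-((k + 1 : ℕ) : ℤ) : ℤ) : ℝ) + d) =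
        ((p : ℝ) ^ (-c)) ^ (k + 1) * (p : ℝ) ^ d := by
      rw [Real.rpow_add (by linarith), ← Real.rpow_natCast, ← Real.rpow_mul (by linarith)]
      congr 2
      push_cast; ring
    rw [h3] at h2
    calc _ ≤ ((p : ℝ) ^ (-c)) ^ (k + 1) * (p : ℝ) ^ d * ρ ^ (-((k + 1 : ℕ) : ℤ)) :=
          mul_le_mul_of_nonneg_right h2 (zpow_pos hρ0 _).le
      _ = ((p : ℝ) ^ (-c) / ρ) ^ (k + 1) * (p : ℝ) ^ d := by
          rw [zpow_neg, zpow_natCast, div_pow]; ring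
      _ ≤ ((p : ℝ) ^ (-c) / ρ) ^ M1 * (p : ℝ) ^ d :=
          mul_le_mul_of_nonneg_right (pow_le_pow_of_le_one ha0 ha.le (by omega)) hpd.le
      _ ≤ ε := by rw [← le_div_iff₀ hpd]; exact hM1.le
  obtain ⟨M2, hM2⟩ : ∃ M2 : ℕ, ∀ k : ℕ, M2 ≤ k → S.abv (S.coeff x k) * ρ ^ (k : ℤ) ≤ ε := by
    have hη : 0 < (1 - ρ) := by linarith
    obtain ⟨L, hL0, hL⟩ := S.coeff_growth x (1 - ρ) hη
    have ha : (1 + (1 - ρ)) * ρ < 1 := by nlinarith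
    have ha0 : 0 ≤ (1 + (1 - ρ)) * ρ := by
      apply mul_nonneg <;> linarith
    obtain ⟨M2, hM2⟩ := exists_pow_lt_of_lt_one hε ha
    refine ⟨M2 + L.toNat, fun k hk => ?_⟩
    have h2 := hL k (by omega)
    calc _ ≤ (1 + (1 - ρ)) ^ (k : ℤ) * ρ ^ (k : ℤ) :=
          mul_le_mul_of_nonneg_right h2 (zpow_pos hρ0 _).le
      _ = ((1 + (1 - ρ)) * ρ) ^ k := by rw [zpow_natCast, zpow_natCast, mul_pow]
      _ ≤ ((1 + (1 - ρ)) * ρ) ^ M2 := pow_le_pow_of_le_one ha0 ha.le (by omega)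
      _ ≤ ε := hM2.le
  refine ⟨M1 + M2 + 1, fun n hn => ?_⟩
  push_cast at hn
  rcases le_or_gt 0 n with h0 | h0
  · rw [abs_of_nonneg h0] at hn
    lift n to ℕ using h0
    exact hM2 n (by omega)
  · rw [abs_of_neg h0] at hn
    obtain ⟨k, rfl⟩ : ∃ k : ℕ, n = -((k + 1 : ℕ) : ℤ) := ⟨(-n - 1).toNat, by omega⟩
    exact hM1 k (by omega)

variable {S} in
lemma Tail.bound {ρ : ℝ} (hρ : 0 < ρ) {x : S.Γac} (h : S.Tail ρ x) : ∃ C : ℝ, S.N ρ x C := by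
  obtain ⟨M, hM⟩ := h 1 one_pos
  have hnn : ∀ i, 0 ≤ S.abv (S.coeff x i) * ρ ^ i := fun i =>
    mul_nonneg (S.abv_nonneg _) (zpow_pos hρ i).le
  refine ⟨1 + ∑ i ∈ Finset.Icc (-(M : ℤ)) M, S.abv (S.coeff x i) * ρ ^ i, fun n => ?_⟩
  have h0 : 0 ≤ ∑ i ∈ Finset.Icc (-(M : ℤ)) M, S.abv (S.coeff x i) * ρ ^ i :=
    Finset.sum_nonneg fun i _ => hnn i
  by_cases hn : (M : ℤ) < |n|
  · linarith [hM n hn]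
  · have := Finset.single_le_sum (f := fun i => S.abv (S.coeff x i) * ρ ^ i)
      (s := Finset.Icc (-(M : ℤ)) M) (a := n) (fun i _ => hnn i) (by
        rw [Finset.mem_Icc]
        exact abs_le.1 (not_lt.1 hn))
    linarith

variable {S} in
lemma Tail.approx {ρ : ℝ} {x : S.Γac} (h : S.Tail ρ x) (ε : ℝ) (hε : 0 < ε) :
    ∃ y ∈ S.fin, S.N ρ (y - x) ε := by
  obtain ⟨M, hM⟩ := h ε hε
  refine ⟨S.proj {n | |n| ≤ (M : ℤ)} x, ⟨M, fun n hn => ?_⟩, fun n => ?_⟩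
  · rw [S.coeff_proj, if_neg]
    simpa using hn
  · rw [S.coeff_sub', S.coeff_proj]
    split_ifs with hn
    · rw [sub_self, S.abv_zero', zero_mul]; exact hε.le
    · rw [zero_sub, S.abv_neg']
      exact hM n (by simpa using hn)

lemma Tail.mono_mul {ρ : ℝ} (hρ : 0 < ρ) {x : S.Γac} (h : S.Tail ρ x) (a : S.F) (k : ℤ) :
    S.Tail ρ (S.mono a k * x) := by
  intro ε hε
  have hk := zpow_pos hρ k
  have ha := S.abv_nonneg a
  obtain ⟨M, hM⟩ := h (ε / ((S.abv a + 1) * ρ ^ k)) (by positivity)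
  refine ⟨M + k.natAbs, fun n hn => ?_⟩
  rw [S.coeff_mono_mul, S.abv_mul]
  have h1 := hM (n - k) (by
    push_cast at hn
    have := abs_add_le (n - k) k
    rw [sub_add_cancel] at this
    omega)
  rw [le_div_iff₀ (by positivity)] at h1
  have h2 : ρ ^ n = ρ ^ (n - k) * ρ ^ k := by rw [← zpow_add₀ hρ.ne']; ring_nf
  rw [h2]
  refine le_trans ?_ h1
  have h3 : 0 ≤ S.abv (S.coeff x (n - k)) * ρ ^ (n - k) * ρ ^ k := by
    have := S.abv_nonneg (S.coeff x (n - k))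
    positivity
  nlinarith

lemma generic_countable (d : S.Γac) : {ρ : ℝ | 0 < ρ ∧ ∃ i j : ℤ, i ≠ j ∧ S.coeff d i ≠ 0 ∧
    S.coeff d j ≠ 0 ∧ S.abv (S.coeff d i) * ρ ^ i = S.abv (S.coeff d j) * ρ ^ j}.Countable := by
  have : {ρ : ℝ | 0 < ρ ∧ ∃ i j : ℤ, i ≠ j ∧ S.coeff d i ≠ 0 ∧
    S.coeff d j ≠ 0 ∧ S.abv (S.coeff d i) * ρ ^ i = S.abv (S.coeff d j) * ρ ^ j} ⊆
    ⋃ ij : ℤ × ℤ, {ρ : ℝ | 0 < ρ ∧ ij.1 ≠ ij.2 ∧ S.coeff d ij.1 ≠ 0 ∧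
    S.coeff d ij.2 ≠ 0 ∧ S.abv (S.coeff d ij.1) * ρ ^ ij.1 = S.abv (S.coeff d ij.2) * ρ ^ ij.2} := by
    rintro ρ ⟨h0, i, j, h⟩
    exact Set.mem_iUnion.2 ⟨(i, j), h0, h⟩
  refine (Set.countable_iUnion fun ij => ?_).mono this
  apply Set.Subsingleton.countable
  have key : ∀ ρ : ℝ, 0 < ρ → S.coeff d ij.1 ≠ 0 → 
      S.abv (S.coeff d ij.1) * ρ ^ ij.1 = S.abv (S.coeff d ij.2) * ρ ^ ij.2 →
      ρ ^ (ij.1 - ij.2) = S.abv (S.coeff d ij.2) / S.abv (S.coeff d ij.1) := by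
    intro ρ h0 h1 h2
    have := S.abv_pos' _ h1
    have h3 := zpow_pos h0 ij.2
    rw [zpow_sub₀ h0.ne', div_eq_div_iff h3.ne' this.ne']
    linarith
  rintro ρ ⟨h0, h1, h2, h3, h4⟩ ρ' ⟨h0', _, _, _, h4'⟩
  have h5 := (key ρ h0 h2 h4).trans (key ρ' h0' h2 h4').symm
  exact (zpow_left_inj₀ h0.le h0'.le (sub_ne_zero.2 h1)).1 h5

lemma exists_dominant (d : S.Γac) (hd : d ≠ 0) (ρ : ℝ) (hρ : 0 < ρ) (ht : S.Tail ρ d)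
    (hgen : ∀ i j : ℤ, i ≠ j → S.coeff d i ≠ 0 → S.coeff d j ≠ 0 →
      S.abv (S.coeff d i) * ρ ^ i ≠ S.abv (S.coeff d j) * ρ ^ j) :
    ∃ (a : S.F) (k : ℤ) (θ : ℝ), 0 < θ ∧ θ < 1 ∧ S.N ρ (S.mono a k * d - 1) θ := by
  obtain ⟨n1, hn1⟩ : ∃ n, S.coeff d n ≠ 0 := by
    by_contra hcon
    push Not at hcon
    exact hd (S.ext' fun n => by rw [hcon, S.coeff_zero'])
  set f : ℤ → ℝ := fun n => S.abv (S.coeff d n) * ρ ^ n with hf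
  have hfpos : ∀ n, S.coeff d n ≠ 0 → 0 < f n := fun n hn =>
    mul_pos (S.abv_pos' _ hn) (zpow_pos hρ n)
  have hf1 := hfpos n1 hn1
  obtain ⟨M, hM⟩ := ht (f n1 / 2) (by linarith)
  set s := Finset.Icc (-(M : ℤ)) M with hs
  have hns : ∀ n, n ∉ s → f n ≤ f n1 / 2 := by
    intro n hn
    apply hM
    rw [hs, Finset.mem_Icc, ← abs_le] at hn
    omega
  have hn1s : n1 ∈ s := by
    by_contra hcon
    linarith [hns n1 hcon]
  obtain ⟨k, hks, hk⟩ := Finset.exists_max_image s f ⟨n1, hn1s⟩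
  have hkpos : 0 < f k := hf1.trans_le (hk n1 hn1s)
  have hck : S.coeff d k ≠ 0 := by
    intro h0
    simp only [hf, h0, S.abv_zero', zero_mul] at hkpos
    exact lt_irrefl _ hkpos
  obtain ⟨B, hB0, hB1, hB⟩ := fin_lt (s.erase k) f (f k) hkpos (by
    intro n hn
    rw [Finset.mem_erase] at hn
    refine lt_of_le_of_ne (hk n hn.2) fun heq => ?_
    by_cases hn0 : S.coeff d n = 0
    · simp only [hf, hn0, S.abv_zero', zero_mul] at heq hkpos
      exact hkpos.ne heq
    · exact hgen n k hn.1 hn0 hck heq)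
  have hB' : ∀ n, n ≠ k → f n ≤ max B (f k / 2) := by
    intro n hn
    by_cases hns' : n ∈ s
    · exact (hB n (Finset.mem_erase.2 ⟨hn, hns'⟩)).trans (le_max_left _ _)
    · refine (hns n hns').trans (le_trans ?_ (le_max_right _ _))
      linarith [hk n1 hn1s]
  refine ⟨(S.coeff d k)⁻¹, -k, max B (f k / 2) / f k, ?_, ?_, ?_⟩
  · apply div_pos _ hkpos
    exact lt_of_lt_of_le (by linarith) (le_max_right _ _)
  · rw [div_lt_one hkpos]
    exact max_lt hB1 (by linarith)
  · intro n
    rw [S.coeff_sub', S.coeff_mono_mul, S.coeff_one, sub_neg_eq_add]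
    by_cases hn : n = 0
    · rw [hn, zero_add, inv_mul_cancel₀ hck, if_pos rfl, sub_self, S.abv_zero', zero_mul]
      have : 0 ≤ max B (f k / 2) := hB0.trans (le_max_left _ _)
      positivity
    · rw [if_neg hn, sub_zero, S.abv_mul, S.abv_inv' _ hck, le_div_iff₀ hkpos]
      have h1 := hB' (n + k) (by omega)
      have h2 : (S.abv (S.coeff d k))⁻¹ * S.abv (S.coeff d (n + k)) * ρ ^ n * f k = f (n + k) := by
        have := (S.abv_pos' _ hck).ne'
        simp only [hf]
        rw [zpow_add₀ hρ.ne']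
        field_simp
      rw [h2]; exact h1

end approx

end AnSetting

/-- Factorization of matrices over `Γ_{an,con}`.  Let `U` be a square
matrix over `Γ_{an,con}` with nonzero determinant.  Then there exist a matrix
`V = 1 + ∑_{n≥1} Vₙ tⁿ` with entries in `Ω_an` and a matrix `W` with entries in
`Γ_con[1/p]` such that `U = V · W`. -/
theorem anCon_matrix_factorization {p : ℕ} [Fact p.Prime] (S : AnSetting p) {r : ℕ}
    (U : Matrix (Fin r) (Fin r) S.Γac) (hdet : U.det ≠ 0) :
    ∃ V W : Matrix (Fin r) (Fin r) S.Γac,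
      -- `V` has entries in `Ω_an` and constant term the identity matrix
      (∀ i j, V i j ∈ S.omegaAnSet) ∧
      (∀ i j, S.coeff (V i j) 0 = if i = j then 1 else 0) ∧
      -- `W` has entries in `Γ_con[1/p]`
      (∀ i j, W i j ∈ S.conPSet) ∧
      U = V * W := by
  obtain ⟨ρ, hρ0, hρ1, hTU, hTA, hTd, hgen⟩ : ∃ ρ : ℝ, 0 < ρ ∧ ρ < 1 ∧
      (∀ i j, S.Tail ρ (U i j)) ∧ (∀ i j, S.Tail ρ (U.adjugate i j)) ∧ S.Tail ρ U.det ∧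
      (∀ i j : ℤ, i ≠ j → S.coeff U.det i ≠ 0 → S.coeff U.det j ≠ 0 →
        S.abv (S.coeff U.det i) * ρ ^ i ≠ S.abv (S.coeff U.det j) * ρ ^ j) := by
    have h1 : ∀ᶠ ρ : ℝ in nhdsWithin 1 (Set.Iio 1), (∀ i j, S.Tail ρ (U i j)) ∧
        (∀ i j, S.Tail ρ (U.adjugate i j)) ∧ S.Tail ρ U.det ∧ 0 < ρ := by
      refine Filter.Eventually.and ?_ (Filter.Eventually.and ?_ (Filter.Eventually.and ?_ ?_))
      · exact Filter.eventually_all.2 fun i => Filter.eventually_all.2 fun j => S.eventually_tail _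
      · exact Filter.eventually_all.2 fun i => Filter.eventually_all.2 fun j => S.eventually_tail _
      · exact S.eventually_tail _
      · exact nhdsWithin_le_nhds (eventually_gt_nhds one_pos)
    obtain ⟨l, hl, hsub⟩ := (mem_nhdsLT_iff_exists_Ioo_subset).1 h1
    obtain ⟨ρ, hρb, hρ⟩ := ((S.generic_countable U.det).dense_compl ℝ).exists_between hl
    obtain ⟨a, b, c, d⟩ := hsub hρ
    refine ⟨ρ, d, hρ.2, a, b, c, fun i j hij hi hj heq => hρb ⟨d, i, j, hij, hi, hj, heq⟩⟩
  obtain ⟨a, k, θ, hθ0, hθ1, hdom⟩ := S.exists_dominant U.det hdet ρ hρ0 hTd hgen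
  -- bound for `U`
  obtain ⟨C, hC0, hC⟩ : ∃ C : ℝ, 0 < C ∧ ∀ i j, S.N ρ (U i j) C := by
    choose C hC using fun i j => (hTU i j).bound hρ0
    refine ⟨1 + ∑ i, ∑ j, C i j, ?_, fun i j => (hC i j).mono ?_⟩
    · have : 0 ≤ ∑ i, ∑ j, C i j :=
        Finset.sum_nonneg fun i _ => Finset.sum_nonneg fun j _ => (hC i j).nonneg hρ0
      linarith
    · have h1 : C i j ≤ ∑ j, C i j := Finset.single_le_sum (f := fun j => C i j)
        (fun j _ => (hC i j).nonneg hρ0) (Finset.mem_univ j)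
      have h2 : ∑ j, C i j ≤ ∑ i, ∑ j, C i j := Finset.single_le_sum (f := fun i => ∑ j, C i j)
        (fun i _ => Finset.sum_nonneg fun j _ => (hC i j).nonneg hρ0) (Finset.mem_univ i)
      linarith
  -- approximate inverse of `U` by Laurent polynomials
  set Y0 : Matrix (Fin r) (Fin r) S.Γac := S.mono a k • U.adjugate with hY0
  have hY0T : ∀ i j, S.Tail ρ (Y0 i j) := by
    intro i j
    rw [hY0, Matrix.smul_apply, smul_eq_mul]
    exact AnSetting.Tail.mono_mul S hρ0 (hTA i j) a k
  choose Y' hYf hYN using fun i j => (hY0T i j).approx (θ / C) (by positivity)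
  set Y : Matrix (Fin r) (Fin r) S.Γac := Matrix.of Y' with hY
  set E := U * Y - 1 with hE
  have hEN : ∀ i j, S.N ρ (E i j) θ := by
    have h1 : E = U * (Y - Y0) + (S.mono a k * U.det - 1) • (1 : Matrix (Fin r) (Fin r) S.Γac) := by
      have : U * Y0 = (S.mono a k * U.det) • (1 : Matrix (Fin r) (Fin r) S.Γac) := by
        rw [hY0, Matrix.mul_smul, Matrix.mul_adjugate, smul_smul]
      rw [Matrix.mul_sub, this, sub_smul, one_smul, hE]
      abel
    intro i j
    rw [h1, Matrix.add_apply]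
    apply AnSetting.N.add hρ0
    · have h2 := AnSetting.N.matMul (A := U) (B := Y - Y0) hρ0 hC0.le
        (by positivity : 0 ≤ θ / C) hC (fun i j => hYN i j) i j
      rwa [mul_div_cancel₀ _ hC0.ne'] at h2
    · rw [Matrix.smul_apply, smul_eq_mul, Matrix.one_apply]
      split_ifs
      · rw [mul_one]; exact hdom
      · rw [mul_zero]; exact AnSetting.N.zero hθ0.le
  have hUY : U * Y = 1 + E := by rw [hE]; abel
  have hdetY : Y.det ≠ 0 := by
    intro h0
    apply S.det_one_add_ne_zero ρ hρ0 E θ hθ1 hEN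
    rw [← hUY, Matrix.det_mul, h0, mul_zero]
  have hdetYf : Y.det ∈ S.fin := by
    rw [Matrix.det_apply]
    refine Subring.sum_mem _ fun σ _ => ?_
    rw [Units.smul_def]
    exact Subring.zsmul_mem _ (Subring.prod_mem _ fun i _ => hYf _ _) _
  have hYb : ∀ i j, Y i j ∈ S.bdd := fun i j => S.fin_le_bdd (hYf i j)
  obtain ⟨g, hgb, hg⟩ := S.inv_fin Y.det hdetYf hdetY
  obtain ⟨G, hGN, hG1, hG⟩ := S.fixed_point ρ hρ0 hρ1 E θ hθ0.le hθ1 hEN {n | n ≤ 0}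
    (Or.inl fun n hn => hn)
  obtain ⟨H, hHN, hH1, hH⟩ := S.fixed_point ρ hρ0 hρ1 G θ hθ0.le hθ1 hGN Set.univ
    (Or.inr hG1)
  have hGH : (1 + G) * (1 + H) = 1 := by
    have h0 : H + G + G * H = 0 := by
      ext i j
      apply S.ext'
      intro n
      rw [hH i j n (Set.mem_univ _), Matrix.zero_apply, S.coeff_zero']
    calc (1 + G) * (1 + H) = 1 + (H + G + G * H) := by noncomm_ring
      _ = 1 := by rw [h0, add_zero]
  have hYinv : Y * (g • Y.adjugate) = 1 := by
    rw [Matrix.mul_smul, Matrix.mul_adjugate, smul_smul, mul_comm g, hg, one_smul]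
  have hV : U * Y * (1 + G) = 1 + (G + E + E * G) := by
    rw [hUY]; noncomm_ring
  have hVc : ∀ i j n, n ≤ 0 → S.coeff ((U * Y * (1 + G)) i j) n =
      S.coeff ((1 : Matrix (Fin r) (Fin r) S.Γac) i j) n := by
    intro i j n hn
    rw [hV, Matrix.add_apply, S.coeff_add, hG i j n hn, add_zero]
  have hadj : ∀ i j, Y.adjugate i j ∈ S.bdd := by
    intro i j
    rw [Matrix.adjugate_apply, Matrix.det_apply]
    refine Subring.sum_mem _ fun σ _ => ?_
    rw [Units.smul_def]
    refine Subring.zsmul_mem _ (Subring.prod_mem _ fun l _ => ?_) _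
    rw [Matrix.updateRow_apply]
    split_ifs
    · rw [Pi.single_apply]
      split_ifs
      · exact S.bdd.one_mem
      · exact S.bdd.zero_mem
    · exact hYb _ _
  refine ⟨U * Y * (1 + G), (1 + H) * (g • Y.adjugate), ?_, ?_, ?_, ?_⟩
  · intro i j n hn
    rw [hVc i j n hn.le, Matrix.one_apply]
    split_ifs
    · rw [S.coeff_one, if_neg hn.ne]
    · exact S.coeff_zero' n
  · intro i j
    rw [hVc i j 0 le_rfl, Matrix.one_apply]
    by_cases hij : i = j
    · rw [if_pos hij, if_pos hij, S.coeff_one, if_pos rfl]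
    · rw [if_neg hij, if_neg hij, S.coeff_zero']
  · intro i j
    change _ ∈ S.bdd
    rw [Matrix.mul_apply]
    refine Subring.sum_mem _ fun l _ => S.bdd.mul_mem ?_ ?_
    · rw [Matrix.add_apply, Matrix.one_apply]
      refine S.bdd.add_mem ?_ ⟨1, hH1 i l⟩
      split_ifs
      · exact S.bdd.one_mem
      · exact S.bdd.zero_mem
    · rw [Matrix.smul_apply, smul_eq_mul]
      exact S.bdd.mul_mem hgb (hadj l j)
  · calc U = U * (Y * (g • Y.adjugate)) := by rw [hYinv, mul_one]
      _ = U * Y * ((1 + G) * (1 + H)) * (g • Y.adjugate) := by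
        rw [hGH, mul_one, Matrix.mul_assoc]
      _ = _ := by simp only [Matrix.mul_assoc]
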